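/- For every m ≥ 1 and all indices j, k ∈ {1,…,m}, the operator Y_{jk} := x_j∂_{y_k} + x_k∂_{y_j} − ∂_{z_j}∂_{z_k} commutes with the symplectic Dirac operator: [D_s, Y_{jk}] = 0. -/

import Mathlib

open MvPolynomial Finset

noncomputable section

/-- Polynomials in 3m variables x_1..x_m, y_1..y_m, z_1..z_m. -/
abbrev PS (m : ℕ) : Type := MvPolynomial (Fin m ⊕ Fin m ⊕ Fin m) ℂ

variable (m : ℕ)

/-- partial derivative ∂_{x_j} -/
def dx (j : Fin m) : Module.End ℂ (PS m) := (pderiv (Sum.inl j)).toLinearMap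
/-- partial derivative ∂_{y_j} -/
def dy (j : Fin m) : Module.End ℂ (PS m) := (pderiv (Sum.inr (Sum.inl j))).toLinearMap
/-- partial derivative ∂_{z_j} -/
def dz (j : Fin m) : Module.End ℂ (PS m) := (pderiv (Sum.inr (Sum.inr j))).toLinearMap
/-- multiplication by x_j -/
def mx (j : Fin m) : Module.End ℂ (PS m) := LinearMap.mulLeft ℂ (X (Sum.inl j))
/-- multiplication by y_j -/
def my (j : Fin m) : Module.End ℂ (PS m) := LinearMap.mulLeft ℂ (X (Sum.inr (Sum.inl j)))
/-- multiplication by z_j -/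
def mz (j : Fin m) : Module.End ℂ (PS m) := LinearMap.mulLeft ℂ (X (Sum.inr (Sum.inr j)))

/-- symplectic Dirac operator D_s = ⟨z,∂_y⟩ − ⟨∂_z,∂_x⟩ -/
def Ds : Module.End ℂ (PS m) := (∑ j, mz m j * dy m j) - ∑ j, dz m j * dx m j
/-- adjoint X_s = ⟨y,∂_z⟩ + ⟨x,z⟩ -/
def Xs : Module.End ℂ (PS m) := (∑ j, my m j * dz m j) + ∑ j, mx m j * mz m j
/-- Euler operator in x -/
def Ex : Module.End ℂ (PS m) := ∑ j, mx m j * dx m j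
/-- Euler operator in y -/
def Ey : Module.End ℂ (PS m) := ∑ j, my m j * dy m j
/-- Euler operator in z -/
def Ez : Module.End ℂ (PS m) := ∑ j, mz m j * dz m j
/-- Δ_x -/
def lapX : Module.End ℂ (PS m) := ∑ j, dx m j * dx m j
/-- Δ_y -/
def lapY : Module.End ℂ (PS m) := ∑ j, dy m j * dy m j
/-- Δ_z -/
def lapZ : Module.End ℂ (PS m) := ∑ j, dz m j * dz m j
/-- ⟨∂_x,∂_y⟩ -/
def dxdy : Module.End ℂ (PS m) := ∑ j, dx m j * dy m j
/-- ⟨∂_y,∂_z⟩ -/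
def dydz : Module.End ℂ (PS m) := ∑ j, dy m j * dz m j
/-- ⟨∂_x,∂_z⟩ = ⟨∂_z,∂_x⟩ -/
def dxdz : Module.End ℂ (PS m) := ∑ j, dx m j * dz m j
/-- ⟨x,∂_y⟩ -/
def xdy : Module.End ℂ (PS m) := ∑ j, mx m j * dy m j
/-- ⟨y,∂_x⟩ -/
def ydx : Module.End ℂ (PS m) := ∑ j, my m j * dx m j
/-- ⟨x,∂_z⟩ -/
def xdz : Module.End ℂ (PS m) := ∑ j, mx m j * dz m j
/-- ⟨z,∂_x⟩ -/
def zdx : Module.End ℂ (PS m) := ∑ j, mz m j * dx m j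
/-- ⟨y,∂_z⟩ -/
def ydz : Module.End ℂ (PS m) := ∑ j, my m j * dz m j
/-- ⟨z,∂_y⟩ -/
def zdy : Module.End ℂ (PS m) := ∑ j, mz m j * dy m j
/-- multiplication by |x|² -/
def nx2 : Module.End ℂ (PS m) := ∑ j, mx m j * mx m j
/-- multiplication by |y|² -/
def ny2 : Module.End ℂ (PS m) := ∑ j, my m j * my m j
/-- multiplication by |z|² -/
def nz2 : Module.End ℂ (PS m) := ∑ j, mz m j * mz m j
/-- multiplication by ⟨x,y⟩ -/
def mxy : Module.End ℂ (PS m) := ∑ j, mx m j * my m j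
/-- multiplication by ⟨y,z⟩ -/
def myz : Module.End ℂ (PS m) := ∑ j, my m j * mz m j
/-- multiplication by ⟨x,z⟩ -/
def mxz : Module.End ℂ (PS m) := ∑ j, mx m j * mz m j
/-- L = ⟨x,∂_y⟩ − (1/2)Δ_z -/
def Lop : Module.End ℂ (PS m) := xdy m - (1/2 : ℂ) • lapZ m
/-- R = ⟨y,∂_x⟩ + (1/2)|z|² -/
def Rop : Module.End ℂ (PS m) := ydx m + (1/2 : ℂ) • nz2 m

/-- Y_{jk} := x_j∂_{y_k} + x_k∂_{y_j} − ∂_{z_j}∂_{z_k} -/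
def Yjk (j k : Fin m) : Module.End ℂ (PS m) :=
  mx m j * dy m k + mx m k * dy m j - dz m j * dz m k

theorem pderiv_pderiv_comm {R σ : Type*} [CommRing R] (i j : σ) (p : MvPolynomial σ R) :
    pderiv i (pderiv j p) = pderiv j (pderiv i p) := by
  classical
  have h : ⁅pderiv (R := R) i, pderiv (R := R) j⁆ = 0 := by
    ext k
    simp [Derivation.commutator_apply, pderiv_X, Pi.single_apply, apply_ite (pderiv _)]
  exact sub_eq_zero.mp (by
    simpa [Derivation.commutator_apply] using DFunLike.congr_fun h p)

theorem dy_mul_dz_comm (j k : Fin m) : dy m j * dz m k = dz m k * dy m j :=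
  LinearMap.ext fun p => pderiv_pderiv_comm _ _ p

theorem lie_Ds_mx (j : Fin m) : ⁅Ds m, mx m j⁆ = -dz m j := by
  refine LinearMap.ext fun p => ?_
  simp [Ring.lie_def, Ds, mx, dx, dy, dz, mz, pderiv_X, Pi.single_apply, Finset.mul_sum, mul_sub,
    mul_left_comm, Finset.sum_add_distrib, apply_ite (pderiv _)]

theorem lie_Ds_dy (j : Fin m) : ⁅Ds m, dy m j⁆ = 0 := by
  refine LinearMap.ext fun p => ?_
  simp [Ring.lie_def, Ds, dx, dy, dz, mz, pderiv_X,
    pderiv_pderiv_comm (Sum.inr (Sum.inl j))]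

theorem lie_Ds_dz (j : Fin m) : ⁅Ds m, dz m j⁆ = -dy m j := by
  refine LinearMap.ext fun p => ?_
  simp [Ring.lie_def, Ds, dx, dy, dz, mz, pderiv_X, Pi.single_apply, Finset.sum_add_distrib,
    pderiv_pderiv_comm (Sum.inr (Sum.inr j))]

theorem Ring.lie_mul {A : Type*} [Ring A] (a b c : A) : ⁅a, b * c⁆ = ⁅a, b⁆ * c + b * ⁅a, c⁆ := by
  simp only [Ring.lie_def]
  noncomm_ring

/-- An abstract form of the commutation of the Dirac operator with `Yjk`, using only the
commutators of the Dirac operator with the generators. -/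
theorem lie_symmetrized_eq_zero {A : Type*} [Ring A] {D x x' y y' z z' : A}
    (hx : ⁅D, x⁆ = -z) (hx' : ⁅D, x'⁆ = -z') (hy : ⁅D, y⁆ = 0) (hy' : ⁅D, y'⁆ = 0)
    (hz : ⁅D, z⁆ = -y) (hz' : ⁅D, z'⁆ = -y') (hc : y * z' = z' * y) :
    ⁅D, x * y' + x' * y - z * z'⁆ = 0 := by
  have key : ⁅D, x * y' + x' * y - z * z'⁆ = ⁅D, x * y'⁆ + ⁅D, x' * y⁆ - ⁅D, z * z'⁆ := by
    simp only [Ring.lie_def]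
    noncomm_ring
  rw [key]
  simp only [Ring.lie_mul, hx, hx', hy, hy', hz, hz', neg_mul, mul_neg, mul_zero, hc]
  abel

/-- [D_s, Y_{jk}] = 0. -/
theorem stmt3 : ∀ m : ℕ, 1 ≤ m → ∀ j k : Fin m, ⁅Ds m, Yjk m j k⁆ = 0 := by
  intro m _ j k
  exact lie_symmetrized_eq_zero (lie_Ds_mx m j) (lie_Ds_mx m k) (lie_Ds_dy m j) (lie_Ds_dy m k)
    (lie_Ds_dz m j) (lie_Ds_dz m k) (dy_mul_dz_comm m j k)
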